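/- The Green's function g satisfies the Neumann boundary conditions: for every t > 0 and y ∈ [0,L], the function x ↦ g(t,x,y) (defined by the same series for all x ∈ ℝ) is differentiable, and its derivative with respect to x vanishes at x = 0 and at x = L, i.e. ∂g/∂x (t, 0, y) = ∂g/∂x (t, L, y) = 0. -/

import Mathlib

open MeasureTheory Real Set

/-- The one-dimensional heat kernel `p(t,x) = (4πt)^(−1/2) · exp(−x²/(4t))`. -/
noncomputable def heatKernel (t x : ℝ) : ℝ :=
  (Real.sqrt (4 * Real.pi * t))⁻¹ * Real.exp (-(x ^ 2) / (4 * t))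

/-- The Green's function of the heat equation on `[0,L]` with Neumann boundary
conditions. -/
noncomputable def greenNeumann (L t x y : ℝ) : ℝ :=
  ∑' n : ℤ, (heatKernel t (x - y - 2 * (n : ℝ) * L) + heatKernel t (x + y - 2 * (n : ℝ) * L))

/-- The `2L`-periodization of the heat kernel, extended to complex space arguments and expressed
through the two-variable Jacobi theta function. -/
noncomputable def periodizedHeatKernel (L t : ℝ) (z : ℂ) : ℂ :=
  (((Real.sqrt (4 * Real.pi * t))⁻¹ : ℝ) : ℂ) * Complex.exp (-(z ^ 2) / (4 * t)) *
    jacobiTheta₂ (z * L / (2 * Real.pi * Complex.I * t))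
      (((L ^ 2 / (Real.pi * t) : ℝ) : ℂ) * Complex.I)

lemma im_ofReal_sq_div_pi_mul_I_pos {L t : ℝ} (hL : L ≠ 0) (ht : 0 < t) :
    0 < (((L ^ 2 / (Real.pi * t) : ℝ) : ℂ) * Complex.I).im := by
  rw [Complex.im_ofReal_mul, Complex.I_im, mul_one]
  positivity

lemma hasSum_periodizedHeatKernel {L t : ℝ} (hL : L ≠ 0) (ht : 0 < t) (x : ℝ) :
    HasSum (fun n : ℤ => heatKernel t (x - 2 * (n : ℝ) * L)) (periodizedHeatKernel L t x).re := by
  have h := ((hasSum_jacobiTheta₂_term ((x : ℂ) * L / (2 * Real.pi * Complex.I * t))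
    (im_ofReal_sq_div_pi_mul_I_pos hL ht)).mul_left
    ((((Real.sqrt (4 * Real.pi * t))⁻¹ : ℝ) : ℂ) * Complex.exp (-((x : ℂ) ^ 2) / (4 * t))))
  rw [← periodizedHeatKernel] at h
  convert Complex.hasSum_re h using 2 with n
  rw [← Complex.ofReal_re (heatKernel _ _)]
  congr 1
  have hpi : (Real.pi : ℂ) ≠ 0 := by exact_mod_cast Real.pi_ne_zero
  have ht' : (t : ℂ) ≠ 0 := by exact_mod_cast ht.ne'
  rw [heatKernel, jacobiTheta₂_term, mul_assoc (Complex.ofReal _), ← Complex.exp_add,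
    Complex.ofReal_mul, Complex.ofReal_exp]
  congr 2
  push_cast
  field_simp
  ring_nf
  simp only [Complex.I_sq]
  ring

lemma differentiable_periodizedHeatKernel {L t : ℝ} (hL : L ≠ 0) (ht : 0 < t) :
    Differentiable ℂ (periodizedHeatKernel L t) := by
  intro z
  have h := (differentiableAt_jacobiTheta₂_fst (z * L / (2 * Real.pi * Complex.I * t))
    (im_ofReal_sq_div_pi_mul_I_pos hL ht)).comp z
    (f := fun z : ℂ => z * L / (2 * Real.pi * Complex.I * t)) (by fun_prop)
  exact DifferentiableAt.mul (by fun_prop) h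

lemma greenNeumann_eq_re_add_re {L t : ℝ} (hL : L ≠ 0) (ht : 0 < t) (x y : ℝ) :
    greenNeumann L t x y =
      (periodizedHeatKernel L t (x - y : ℝ)).re + (periodizedHeatKernel L t (x + y : ℝ)).re :=
  ((hasSum_periodizedHeatKernel hL ht _).add (hasSum_periodizedHeatKernel hL ht _)).tsum_eq

lemma differentiable_greenNeumann {L t : ℝ} (hL : L ≠ 0) (ht : 0 < t) (y : ℝ) :
    Differentiable ℝ (fun x => greenNeumann L t x y) := by
  have h : Differentiable ℝ (fun x : ℝ => (periodizedHeatKernel L t x).re) := fun x =>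
    (differentiable_periodizedHeatKernel hL ht x).hasDerivAt.real_of_complex.differentiableAt
  simp only [greenNeumann_eq_re_add_re hL ht]
  exact (h.comp (differentiable_id.sub_const y)).add (h.comp (differentiable_id.add_const y))

lemma heatKernel_neg (t x : ℝ) : heatKernel t (-x) = heatKernel t x := by
  simp [heatKernel]

/-- Reflecting the space variable at an integer multiple of `L` leaves the Green's function
unchanged. -/
lemma greenNeumann_reflect (L t x y : ℝ) (k : ℤ) :
    greenNeumann L t (2 * k * L - x) y = greenNeumann L t x y := by
  unfold greenNeumann
  rw [← (Equiv.subLeft k).tsum_eq]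
  refine tsum_congr fun n => ?_
  rw [add_comm, Equiv.subLeft_apply]
  congr 1 <;> rw [← heatKernel_neg] <;> congr 1 <;> push_cast <;> ring

lemma deriv_eq_zero_of_reflect {f : ℝ → ℝ} {a : ℝ} (h : ∀ x, f (2 * a - x) = f x) :
    deriv f a = 0 := by
  have h1 := deriv_comp_const_sub f (2 * a) a
  rw [funext h, show 2 * a - a = a by ring] at h1
  linarith

/-- The Green's function satisfies the Neumann boundary conditions: for every `t > 0`
and `y ∈ [0,L]`, the function `x ↦ g(t,x,y)` (defined by the same series for all
`x ∈ ℝ`) is differentiable and its derivative vanishes at `x = 0` and `x = L`. -/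
theorem greenNeumann_neumann_boundary (L : ℝ) (hL : 0 < L) (t y : ℝ) (ht : 0 < t)
    (hy : y ∈ Set.Icc (0 : ℝ) L) :
    Differentiable ℝ (fun x => greenNeumann L t x y) ∧
    deriv (fun x => greenNeumann L t x y) 0 = 0 ∧
    deriv (fun x => greenNeumann L t x y) L = 0 := by
  refine ⟨differentiable_greenNeumann hL.ne' ht y, deriv_eq_zero_of_reflect fun x => ?_,
    deriv_eq_zero_of_reflect fun x => ?_⟩
  · simpa using greenNeumann_reflect L t x y 0
  · simpa using greenNeumann_reflect L t x y 1
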